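/- For every g ∈ G(Γ), the wall distance from the identity to g satisfies d_𝕎(e, g) = 2|g|_r. -/

import Mathlib

open scoped ComplexOrder

/-! ## Operator-norm notions -/

/-- `φ` is completely bounded (as a Herz–Schur multiplier) with cb-norm at most `C`:
there are a Hilbert space `H` and bounded maps `α β : G → H` with
`φ (h⁻¹ * g) = ⟪α g, β h⟫` and `(sup ‖α‖) * (sup ‖β‖) ≤ C`. -/
def HasCBNormBound {G : Type} [Group G] (φ : G → ℂ) (C : ℝ) : Prop :=
  ∃ (H : Type) (_ : NormedAddCommGroup H) (_ : InnerProductSpace ℂ H)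
    (α β : G → H) (Ca Cb : ℝ),
      (∀ g, ‖α g‖ ≤ Ca) ∧ (∀ h, ‖β h‖ ≤ Cb) ∧ Ca * Cb ≤ C ∧
      ∀ g h : G, φ (h⁻¹ * g) = (inner ℂ (α g) (β h) : ℂ)

/-- A kernel `φ : G × G → ℂ` is completely bounded with cb-norm at most `C`. -/
def HasCBKernelBound {G : Type} (φ : G → G → ℂ) (C : ℝ) : Prop :=
  ∃ (H : Type) (_ : NormedAddCommGroup H) (_ : InnerProductSpace ℂ H)
    (α β : G → H) (Ca Cb : ℝ),
      (∀ g, ‖α g‖ ≤ Ca) ∧ (∀ h, ‖β h‖ ≤ Cb) ∧ Ca * Cb ≤ C ∧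
      ∀ g h : G, φ g h = (inner ℂ (α g) (β h) : ℂ)

/-- A function `φ : G → ℂ` is positive definite. -/
def IsPosDefFn {G : Type} [Group G] (φ : G → ℂ) : Prop :=
  ∀ (n : ℕ) (c : Fin n → ℂ) (x : Fin n → G),
    0 ≤ ∑ i, ∑ j, c i * (starRingEnd ℂ) (c j) * φ ((x j)⁻¹ * x i)

/-- A kernel `Ψ : G × G → ℂ` is positive definite. -/
def IsPosDefKernel {X : Type} (Ψ : X → X → ℂ) : Prop :=
  ∀ (n : ℕ) (c : Fin n → ℂ) (x : Fin n → X),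
    0 ≤ ∑ i, ∑ j, c i * (starRingEnd ℂ) (c j) * Ψ (x i) (x j)

/-- A (discrete) group is amenable iff it admits an approximate identity of finitely
supported positive definite functions; we use this characterization. -/
def AmenablePD (G : Type) [Group G] : Prop :=
  ∀ (S : Finset G) (ε : ℝ), 0 < ε →
    ∃ φ : G → ℂ, (Function.support φ).Finite ∧ IsPosDefFn φ ∧ ∀ g ∈ S, ‖φ g - 1‖ < ε

/-- A group is weakly amenable with Cowling–Haagerup constant 1: there is a net of finitely
supported completely bounded functions converging to 1 pointwise with cb-norms with
limsup at most 1. -/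
def WeaklyAmenableCH1 (G : Type) [Group G] : Prop :=
  ∀ (S : Finset G) (ε : ℝ), 0 < ε →
    ∃ φ : G → ℂ, (Function.support φ).Finite ∧ HasCBNormBound φ (1 + ε) ∧
      ∀ g ∈ S, ‖φ g - 1‖ < ε

/-! ## Graph products -/

section GraphProd

variable {V : Type} (Γ : SimpleGraph V) (G : V → Type) [∀ v, Group (G v)]

open scoped commutatorElement in
/-- The commutators `[G_v, G_w]` over the edges of `Γ`. -/
def commRels : Set (Monoid.CoprodI G) :=
  {x | ∃ (v w : V) (a : G v) (b : G w), Γ.Adj v w ∧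
    x = ⁅Monoid.CoprodI.of a, Monoid.CoprodI.of b⁆}

/-- The graph product of the groups `G v` over the graph `Γ`. -/
abbrev GraphProduct :=
  Monoid.CoprodI G ⧸ Subgroup.normalClosure (commRels Γ G)

/-- The image in the graph product of a syllable, i.e. an element of a vertex group. -/
def ofSyl (s : (v : V) × G v) : GraphProduct Γ G :=
  QuotientGroup.mk (Monoid.CoprodI.of s.2)

/-- The element of the graph product represented by a formal word of syllables. -/
def wordProd (w : List ((v : V) × G v)) : GraphProduct Γ G :=
  (w.map (ofSyl Γ G)).prod

/-- `w` is a formal word of nontrivial syllables representing `g`. -/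
def IsWordOf (w : List ((v : V) × G v)) (g : GraphProduct Γ G) : Prop :=
  (∀ s ∈ w, s.2 ≠ 1) ∧ wordProd Γ G w = g

/-- The reduced word length `|g|_r`. -/
noncomputable def redLength (g : GraphProduct Γ G) : ℕ :=
  sInf {n | ∃ w, IsWordOf Γ G w g ∧ w.length = n}

/-- `w` is a reduced word representing `g` : a representing word of nontrivial syllables
of minimal syllable length. -/
def IsReducedWordOf (w : List ((v : V) × G v)) (g : GraphProduct Γ G) : Prop :=
  IsWordOf Γ G w g ∧ ∀ w', IsWordOf Γ G w' g → w.length ≤ w'.length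

/-- `κ`: the maximal number of mutually adjacent vertices of `Γ`. -/
noncomputable def kappa : ℕ :=
  sSup {n | ∃ s : Finset V, Γ.IsNClique n s}

/-- The `d`-tail of `g`: syllables appearing among the last `d` syllables of some reduced
word representing `g`. -/
def dTail (g : GraphProduct Γ G) (d : ℕ) : Set ((v : V) × G v) :=
  {s | ∃ w, IsReducedWordOf Γ G w g ∧ s ∈ w.drop (w.length - d)}

/-- `g` begins with `G_v`. -/
def BeginsWith (g : GraphProduct Γ G) (v : V) : Prop :=
  ∃ w s, IsReducedWordOf Γ G w g ∧ w.head? = some s ∧ s.1 = v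

/-- `g` ends with `G(lk(v))`: some reduced word for `g` has last syllable in a vertex
group adjacent to `v`. -/
def EndsWithLink (g : GraphProduct Γ G) (v : V) : Prop :=
  ∃ w s, IsReducedWordOf Γ G w g ∧ w.getLast? = some s ∧ Γ.Adj s.1 v

/-- The half-space `𝔸_v` of elements beginning with `G_v`. -/
noncomputable def halfSpace (v : V) : Set (GraphProduct Γ G) :=
  {g | ∃ gv : G v, redLength Γ G (ofSyl Γ G ⟨v, gv⟩ * g) < redLength Γ G g}

/-- Left translate `k • s` of a subset of the graph product. -/
def wallTrans (k : GraphProduct Γ G) (s : Set (GraphProduct Γ G)) : Set (GraphProduct Γ G) :=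
  (fun x => k * x) '' s

/-- Two walls (given by their preferred half-spaces) cross if all four intersections of
half-spaces are nonempty. -/
def Cross {X : Type} (s t : Set X) : Prop :=
  (s ∩ t).Nonempty ∧ (s ∩ tᶜ).Nonempty ∧ (sᶜ ∩ t).Nonempty ∧ (sᶜ ∩ tᶜ).Nonempty

/-- The set of walls `𝕎 = {k𝔸_v}`. -/
noncomputable def Walls : Set (Set (GraphProduct Γ G)) :=
  {s | ∃ (k : GraphProduct Γ G) (v : V), s = wallTrans Γ G k (halfSpace Γ G v)}

/-- The wall (pseudo)distance: the number of walls separating `x` and `y`. -/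
noncomputable def wallDist (x y : GraphProduct Γ G) : ℕ :=
  {s | s ∈ Walls Γ G ∧ Xor' (x ∈ s) (y ∈ s)}.ncard

end GraphProd


/-- The image in the free product `A ∗ B` of a syllable. -/
def sylEmb (A B : Type) [Group A] [Group B] : A ⊕ B → Monoid.Coprod A B :=
  Sum.elim (fun a => Monoid.Coprod.inl a) (fun b => Monoid.Coprod.inr b)


section Aux

open Classical in
/-- component at `v` of a syllable of type `u` -/
noncomputable def piV {V : Type} (G : V → Type) [∀ v, Group (G v)] (v u : V) : G u →* G v :=
  (Pi.evalMonoidHom G v).comp (MonoidHom.mulSingle G u)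

variable {V : Type} (Γ : SimpleGraph V) (G : V → Type) [∀ v, Group (G v)]

theorem piV_self (v : V) (a : G v) : piV G v v a = a := by simp [piV]

theorem piV_ne {v u : V} (h : u ≠ v) (a : G u) : piV G v u a = 1 := by
  classical
  simp only [piV, MonoidHom.comp_apply, MonoidHom.mulSingle_apply, Pi.evalMonoidHom_apply]
  exact Pi.mulSingle_eq_of_ne h.symm _

theorem ofSyl_mul (u : V) (a b : G u) :
    ofSyl Γ G ⟨u, a * b⟩ = ofSyl Γ G ⟨u, a⟩ * ofSyl Γ G ⟨u, b⟩ := by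
  simp [ofSyl]

theorem ofSyl_one (u : V) : ofSyl Γ G ⟨u, 1⟩ = 1 := by
  simp [ofSyl]

theorem ofSyl_inv (u : V) (a : G u) :
    ofSyl Γ G ⟨u, a⁻¹⟩ = (ofSyl Γ G ⟨u, a⟩)⁻¹ := by
  simp [ofSyl]

open scoped commutatorElement in
theorem ofSyl_comm {u w : V} (h : Γ.Adj u w) (a : G u) (b : G w) :
    ofSyl Γ G ⟨u, a⟩ * ofSyl Γ G ⟨w, b⟩ = ofSyl Γ G ⟨w, b⟩ * ofSyl Γ G ⟨u, a⟩ := by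
  rw [← commutatorElement_eq_one_iff_mul_comm]
  have : (QuotientGroup.mk' (Subgroup.normalClosure (commRels Γ G)))
      (⁅(Monoid.CoprodI.of a : Monoid.CoprodI G), Monoid.CoprodI.of b⁆) = 1 := by
    apply (QuotientGroup.eq_one_iff _).2
    exact Subgroup.subset_normalClosure ⟨u, w, a, b, h, rfl⟩
  rw [map_commutatorElement] at this
  exact this

/-- universal property -/
noncomputable def gpLift {K : Type} [Group K] (φ : ∀ u, G u →* K)
    (h : ∀ u w, Γ.Adj u w → ∀ a b, φ u a * φ w b = φ w b * φ u a) : GraphProduct Γ G →* K :=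
  QuotientGroup.lift _ (Monoid.CoprodI.lift φ) (by
    have : Subgroup.normalClosure (commRels Γ G) ≤ (Monoid.CoprodI.lift φ).ker := by
      apply Subgroup.normalClosure_le_normal
      rintro x ⟨u, w, a, b, hab, rfl⟩
      show _ = _
      rw [map_commutatorElement, commutatorElement_eq_one_iff_mul_comm]
      simpa using h u w hab a b
    intro x hx
    exact this hx)

theorem gpLift_ofSyl {K : Type} [Group K] (φ : ∀ u, G u →* K)
    (h : ∀ u w, Γ.Adj u w → ∀ a b, φ u a * φ w b = φ w b * φ u a) (u : V) (a : G u) :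
    gpLift Γ G φ h (ofSyl Γ G ⟨u, a⟩) = φ u a := by
  simp [gpLift, ofSyl]

theorem exists_word (g : GraphProduct Γ G) : ∃ w, wordProd Γ G w = g := by
  induction g using QuotientGroup.induction_on with
  | H z =>
    induction z using Monoid.CoprodI.induction_on with
    | one => exact ⟨[], by simp [wordProd]⟩
    | of i m => exact ⟨[⟨i, m⟩], by simp [wordProd, ofSyl]⟩
    | mul x y hx hy =>
      obtain ⟨a, ha⟩ := hx
      obtain ⟨b, hb⟩ := hy
      exact ⟨a ++ b, by simp [wordProd] at *; rw [ha, hb]⟩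

theorem wordProd_append (w w' : List ((v : V) × G v)) :
    wordProd Γ G (w ++ w') = wordProd Γ G w * wordProd Γ G w' := by
  simp [wordProd]

theorem wordProd_single (s : (v : V) × G v) :
    wordProd Γ G [s] = ofSyl Γ G s := by
  simp [wordProd]

theorem exists_isWordOf (w : List ((v : V) × G v)) :
    ∃ w', IsWordOf Γ G w' (wordProd Γ G w) ∧ w'.length ≤ w.length := by
  induction w with
  | nil => exact ⟨[], ⟨by simp, rfl⟩, le_rfl⟩
  | cons s w ih =>
    obtain ⟨w', ⟨h1, h2⟩, h3⟩ := ih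
    by_cases hs : s.2 = 1
    · refine ⟨w', ⟨h1, ?_⟩, by simp; omega⟩
      obtain ⟨u, a⟩ := s
      change a = 1 at hs
      rw [hs]
      rw [h2, wordProd, wordProd, List.map_cons, List.prod_cons, ofSyl_one, one_mul]
    · refine ⟨s :: w', ⟨?_, ?_⟩, by simp; omega⟩
      · intro t ht
        rcases List.mem_cons.1 ht with rfl | ht
        · exact hs
        · exact h1 t ht
      · rw [wordProd] at *
        rw [wordProd] at *
        simp [h2]

theorem redLength_le (w : List ((v : V) × G v)) :
    redLength Γ G (wordProd Γ G w) ≤ w.length := by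
  obtain ⟨w', h, h'⟩ := exists_isWordOf Γ G w
  exact le_trans (Nat.sInf_le ⟨w', h, rfl⟩) h'

theorem exists_red (g : GraphProduct Γ G) :
    ∃ w, IsWordOf Γ G w g ∧ w.length = redLength Γ G g := by
  obtain ⟨w, rfl⟩ := exists_word Γ G g
  obtain ⟨w', h, h'⟩ := exists_isWordOf Γ G w
  exact Nat.sInf_mem (s := {n | ∃ w', IsWordOf Γ G w' (wordProd Γ G w) ∧ w'.length = n})
    ⟨_, w', h, rfl⟩

theorem redLength_mul_syl (g : GraphProduct Γ G) (s : (v : V) × G v) :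
    redLength Γ G (g * ofSyl Γ G s) ≤ redLength Γ G g + 1 := by
  obtain ⟨w, ⟨_, rfl⟩, h⟩ := exists_red Γ G g
  rw [← h, ← wordProd_single, ← wordProd_append]
  exact (redLength_le Γ G _).trans (by simp)

theorem redLength_inv_le (g : GraphProduct Γ G) :
    redLength Γ G g⁻¹ ≤ redLength Γ G g := by
  obtain ⟨w, ⟨_, rfl⟩, h⟩ := exists_red Γ G g
  rw [← h]
  have : ∀ w, ∃ w', wordProd Γ G w' = (wordProd Γ G w)⁻¹ ∧ w'.length = w.length := by
    intro w
    induction w with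
    | nil => exact ⟨[], by simp [wordProd], rfl⟩
    | cons s w ih =>
      obtain ⟨w', h1, h2⟩ := ih
      refine ⟨w' ++ [⟨s.1, s.2⁻¹⟩], ?_, by simp [h2]⟩
      rw [wordProd_append, h1, wordProd_single, ofSyl_inv]
      simp [wordProd]
  obtain ⟨w', h1, h2⟩ := this w
  rw [← h1, ← h2]
  exact redLength_le Γ G _

theorem redLength_inv (g : GraphProduct Γ G) :
    redLength Γ G g⁻¹ = redLength Γ G g :=
  le_antisymm (redLength_inv_le Γ G g) (by simpa using redLength_inv_le Γ G g⁻¹)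

/-- the star subgroup -/
def starSub (v : V) : Subgroup (GraphProduct Γ G) :=
  Subgroup.closure {x | ∃ u a, (u = v ∨ Γ.Adj u v) ∧ x = ofSyl Γ G ⟨u, a⟩}

theorem syl_mem_star {v u : V} (h : u = v ∨ Γ.Adj u v) (a : G u) :
    ofSyl Γ G ⟨u, a⟩ ∈ starSub Γ G v := Subgroup.subset_closure ⟨u, a, h, rfl⟩

open Classical in
/-- action of a syllable -/
noncomputable def actEnd (v u : V) : G u →* Function.End (G v × GraphProduct Γ G) where
  toFun s := fun p => (if p.2 ∈ starSub Γ G v then piV G v u s * p.1 else p.1,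
    ofSyl Γ G ⟨u, s⟩ * p.2)
  map_one' := by
    funext p
    simp [ofSyl_one]
    rfl
  map_mul' s t := by
    funext p
    show _ = (_, _ * (_ * _))
    by_cases h : u = v
    · subst h
      have := (starSub Γ G u).mul_mem_cancel_left (y := p.2)
        (syl_mem_star Γ G (v := u) (Or.inl rfl) t)
      simp only [ofSyl_mul, mul_assoc, map_mul, this]
      split_ifs <;> rfl
    · simp [ofSyl_mul, mul_assoc, piV_ne G h]

theorem actEnd_apply (v u : V) (s : G u) (p : G v × GraphProduct Γ G) [Decidable (p.2 ∈ starSub Γ G v)] :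
    actEnd Γ G v u s p = (if p.2 ∈ starSub Γ G v then piV G v u s * p.1 else p.1,
    ofSyl Γ G ⟨u, s⟩ * p.2) := by
  show (_, _) = _
  congr

theorem act_comm (v u w : V) (h : Γ.Adj u w) (a : G u) (b : G w) (p) :
    actEnd Γ G v u a (actEnd Γ G v w b p) = actEnd Γ G v w b (actEnd Γ G v u a p) := by
  classical
  simp only [actEnd_apply]
  rw [← mul_assoc, ofSyl_comm Γ G h, mul_assoc]
  congr 1
  by_cases hu : u = v
  · subst hu
    have h1 := (starSub Γ G u).mul_mem_cancel_left (y := p.2)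
        (syl_mem_star Γ G (v := u) (Or.inr h.symm) b)
    simp [h1, piV_ne G h.ne']
  · by_cases hw : w = v
    · subst hw
      have h1 := (starSub Γ G w).mul_mem_cancel_left (y := p.2)
        (syl_mem_star Γ G (v := w) (Or.inr h) a)
      simp [h1, piV_ne G h.ne]
    · simp [piV_ne G hu, piV_ne G hw]

/-- action of the graph product -/
noncomputable def actHom (v : V) : GraphProduct Γ G →* Equiv.Perm (G v × GraphProduct Γ G) :=
  gpLift Γ G (fun u => (actEnd Γ G v u).toHomPerm) (by
    intro u w h a b
    ext1 p
    exact act_comm Γ G v u w h a b p)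

/-- the gate projection to `G v` -/
noncomputable def gate (v : V) (g : GraphProduct Γ G) : G v :=
  (actHom Γ G v g⁻¹ (1, 1)).1⁻¹

theorem actHom_syl (v u : V) (s : G u) (p) :
    actHom Γ G v (ofSyl Γ G ⟨u, s⟩) p = actEnd Γ G v u s p := by
  rw [actHom, gpLift_ofSyl]; rfl

theorem actHom_snd (v : V) (g : GraphProduct Γ G) (p) :
    (actHom Γ G v g p).2 = g * p.2 := by
  classical
  obtain ⟨w, rfl⟩ := exists_word Γ G g
  induction w with
  | nil => simp [wordProd]
  | cons s w ih =>
    have : wordProd Γ G (s :: w) = ofSyl Γ G s * wordProd Γ G w := by simp [wordProd]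
    rw [this, map_mul, Equiv.Perm.mul_apply, actHom_syl, actEnd_apply, ih, mul_assoc]

open Classical in
theorem gate_mul_syl (v u : V) (g : GraphProduct Γ G) (s : G u) :
    gate Γ G v (g * ofSyl Γ G ⟨u, s⟩) =
      if g ∈ starSub Γ G v then gate Γ G v g * piV G v u s else gate Γ G v g := by
  rw [gate, mul_inv_rev, ← ofSyl_inv, map_mul, Equiv.Perm.mul_apply, actHom_syl, actEnd_apply,
    actHom_snd]
  simp only [mul_one, inv_mem_iff, gate]
  split_ifs <;> simp

theorem gate_one (v : V) : gate Γ G v 1 = 1 := by simp [gate]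

theorem gate_mul (v : V) (h g : GraphProduct Γ G) (hh : h ∈ starSub Γ G v) :
    gate Γ G v (h * g) = gate Γ G v h * gate Γ G v g := by
  classical
  obtain ⟨w, rfl⟩ := exists_word Γ G g
  induction w using List.reverseRecOn with
  | nil => simp [wordProd, gate_one]
  | append_singleton w s ih =>
    rw [wordProd_append, wordProd_single, ← mul_assoc, gate_mul_syl, gate_mul_syl, ih,
      Subgroup.mul_mem_cancel_left _ hh]
    split_ifs <;> simp [mul_assoc]

theorem gate_syl (v : V) (a : G v) : gate Γ G v (ofSyl Γ G ⟨v, a⟩) = a := by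
  classical
  have := gate_mul_syl Γ G v v 1 a
  simpa [gate_one, piV_self, one_mem] using this

open Classical in
/-- retraction to the link subgroup -/
noncomputable def linkHom (v : V) : GraphProduct Γ G →* GraphProduct Γ G :=
  gpLift Γ G (fun u => if Γ.Adj u v then
      (QuotientGroup.mk' (Subgroup.normalClosure (commRels Γ G))).comp Monoid.CoprodI.of else 1) (by
    intro u w h a b
    by_cases h1 : Γ.Adj u v <;> by_cases h2 : Γ.Adj w v <;> simp only [h1, h2, if_true, if_false,
      MonoidHom.one_apply, one_mul, mul_one]
    exact ofSyl_comm Γ G h a b)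

open Classical in
theorem linkHom_syl (v u : V) (a : G u) :
    linkHom Γ G v (ofSyl Γ G ⟨u, a⟩) = if Γ.Adj u v then ofSyl Γ G ⟨u, a⟩ else 1 := by
  rw [linkHom, gpLift_ofSyl]
  split_ifs <;> rfl

theorem linkHom_word (v : V) (w : List ((v : V) × G v)) :
    ∃ w', wordProd Γ G w' = linkHom Γ G v (wordProd Γ G w) ∧ w'.length ≤ w.length ∧
      ∀ s ∈ w', Γ.Adj s.1 v := by
  classical
  induction w with
  | nil => exact ⟨[], by simp [wordProd]⟩
  | cons s w ih =>
    obtain ⟨w', h1, h2, h3⟩ := ih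
    have e : ∀ w, wordProd Γ G (s :: w) = ofSyl Γ G s * wordProd Γ G w := by simp [wordProd]
    by_cases h : Γ.Adj s.1 v
    · refine ⟨s :: w', ?_, by simpa using h2, ?_⟩
      · rw [e, e, map_mul, h1, linkHom_syl, if_pos h]
      · intro t ht
        rcases List.mem_cons.1 ht with rfl | ht
        · exact h
        · exact h3 t ht
    · refine ⟨w', ?_, by simp; omega, h3⟩
      rw [e, map_mul, h1, linkHom_syl, if_neg h, one_mul]

theorem linkHom_comm (v : V) (g : GraphProduct Γ G) (a : G v) :
    linkHom Γ G v g * ofSyl Γ G ⟨v, a⟩ = ofSyl Γ G ⟨v, a⟩ * linkHom Γ G v g := by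
  obtain ⟨w, rfl⟩ := exists_word Γ G g
  obtain ⟨w', h1, h2, h3⟩ := linkHom_word Γ G v w
  rw [← h1]
  clear h1 h2
  induction w' with
  | nil => simp [wordProd]
  | cons s w ih =>
    have e : wordProd Γ G (s :: w) = ofSyl Γ G s * wordProd Γ G w := by simp [wordProd]
    rw [e, mul_assoc, ih (fun t ht => h3 t (List.mem_cons_of_mem _ ht)), ← mul_assoc, ← mul_assoc,
      ofSyl_comm Γ G (h3 s List.mem_cons_self)]

theorem star_decomp (v : V) (g : GraphProduct Γ G) (hg : g ∈ starSub Γ G v) :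
    g = ofSyl Γ G ⟨v, gate Γ G v g⟩ * linkHom Γ G v g := by
  classical
  have key : ∀ (g : GraphProduct Γ G) (u : V) (a : G u), (u = v ∨ Γ.Adj u v) → g ∈ starSub Γ G v →
      g = ofSyl Γ G ⟨v, gate Γ G v g⟩ * linkHom Γ G v g →
      g * ofSyl Γ G ⟨u, a⟩ = ofSyl Γ G ⟨v, gate Γ G v (g * ofSyl Γ G ⟨u, a⟩)⟩ *
        linkHom Γ G v (g * ofSyl Γ G ⟨u, a⟩) := by
    intro g u a hu hg ih
    rw [gate_mul_syl, if_pos hg, map_mul, linkHom_syl, ofSyl_mul]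
    rcases hu with rfl | hu
    · simp only [SimpleGraph.irrefl, if_false, piV_self, mul_one]
      rw [mul_assoc, ← linkHom_comm, ← mul_assoc, ← ih]
    · rw [piV_ne G hu.ne, if_pos hu, ofSyl_one, mul_one, ← mul_assoc, ← ih]
  induction hg using Subgroup.closure_induction_right with
  | one => simp [gate_one, ofSyl_one]
  | mul_right x hx y hy ih =>
    obtain ⟨u, a, hu, rfl⟩ := hy
    exact key x u a hu hx ih
  | mul_inv_cancel x hx y hy ih =>
    obtain ⟨u, a, hu, rfl⟩ := hy
    rw [← ofSyl_inv]
    exact key x u a⁻¹ hu hx ih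

theorem shorten (v : V) (w : List ((v : V) × G v)) (h : gate Γ G v (wordProd Γ G w) ≠ 1) :
    ∃ w', w'.length < w.length ∧
      ofSyl Γ G ⟨v, gate Γ G v (wordProd Γ G w)⟩ * wordProd Γ G w' = wordProd Γ G w := by
  classical
  induction w using List.reverseRecOn with
  | nil => simp [wordProd, gate_one] at h
  | append_singleton w s ih =>
    by_cases hc : gate Γ G v (wordProd Γ G (w ++ [s])) = gate Γ G v (wordProd Γ G w)
    · rw [hc] at h ⊢
      obtain ⟨w', h1, h2⟩ := ih h
      refine ⟨w' ++ [s], by simpa using h1, ?_⟩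
      rw [wordProd_append, ← mul_assoc, h2, wordProd_append]
    · obtain ⟨u, a⟩ := s
      rw [wordProd_append, wordProd_single, gate_mul_syl] at *
      split_ifs at * with hs
      · by_cases hu : u = v
        · subst hu
          obtain ⟨w', h1, h2, _⟩ := linkHom_word Γ G u w
          refine ⟨w', by simp; omega, ?_⟩
          rw [h1, piV_self, ofSyl_mul, mul_assoc, ← linkHom_comm, ← mul_assoc,
            ← star_decomp Γ G u _ hs]
        · simp [piV_ne G hu] at hc
      · exact absurd rfl hc

theorem shorten' (v : V) (g : GraphProduct Γ G) (h : gate Γ G v g ≠ 1) :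
    redLength Γ G ((ofSyl Γ G ⟨v, gate Γ G v g⟩)⁻¹ * g) < redLength Γ G g := by
  obtain ⟨w, ⟨_, rfl⟩, hw⟩ := exists_red Γ G g
  obtain ⟨w', h1, h2⟩ := shorten Γ G v w h
  rw [← hw]
  refine lt_of_le_of_lt ?_ h1
  have : (ofSyl Γ G ⟨v, gate Γ G v (wordProd Γ G w)⟩)⁻¹ * wordProd Γ G w = wordProd Γ G w' := by
    rw [inv_mul_eq_iff_eq_mul, h2]
  rw [this]
  exact redLength_le Γ G _

theorem mem_halfSpace (v : V) (g : GraphProduct Γ G) :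
    g ∈ halfSpace Γ G v ↔ gate Γ G v g ≠ 1 := by
  constructor
  · rintro ⟨a, ha⟩ h
    have e : gate Γ G v (ofSyl Γ G ⟨v, a⟩ * g) = a := by
      rw [gate_mul Γ G v _ _ (syl_mem_star Γ G (Or.inl rfl) a), gate_syl, h, mul_one]
    have ha1 : a ≠ 1 := by
      rintro rfl
      simp [ofSyl_one] at ha
    have := shorten' Γ G v (ofSyl Γ G ⟨v, a⟩ * g) (by rwa [e])
    rw [e, inv_mul_cancel_left] at this
    omega
  · intro h
    exact ⟨(gate Γ G v g)⁻¹, by rw [ofSyl_inv]; exact shorten' Γ G v g h⟩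

theorem mem_wall (k : GraphProduct Γ G) (v : V) (x : GraphProduct Γ G) :
    x ∈ wallTrans Γ G k (halfSpace Γ G v) ↔ gate Γ G v (k⁻¹ * x) ≠ 1 := by
  rw [← mem_halfSpace, wallTrans]
  constructor
  · rintro ⟨y, hy, rfl⟩
    simpa using hy
  · intro h
    exact ⟨_, h, by simp⟩

theorem cross_aux (k : GraphProduct Γ G) (v u : V) (x : GraphProduct Γ G) (s : G u)
    (h1 : x ∉ wallTrans Γ G k (halfSpace Γ G v))
    (h2 : x * ofSyl Γ G ⟨u, s⟩ ∈ wallTrans Γ G k (halfSpace Γ G v)) :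
    wallTrans Γ G k (halfSpace Γ G v) = wallTrans Γ G x (halfSpace Γ G u) := by
  classical
  rw [mem_wall] at h1 h2
  rw [not_not] at h1
  rw [← mul_assoc, gate_mul_syl] at h2
  split_ifs at h2 with hs
  · by_cases hu : u = v
    · subst hu
      ext z
      rw [mem_wall, mem_wall]
      have : k⁻¹ * z = (k⁻¹ * x) * (x⁻¹ * z) := by group
      rw [this, gate_mul Γ G u _ _ hs, h1, one_mul]
    · simp [piV_ne G hu, h1] at h2
  · exact absurd h1 h2

/-- separating walls -/
def sepSet (x y : GraphProduct Γ G) : Set (Set (GraphProduct Γ G)) :=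
  {s | s ∈ Walls Γ G ∧ Xor' (x ∈ s) (y ∈ s)}

theorem sep_edge (x : GraphProduct Γ G) (u : V) (s : G u) (hs : s ≠ 1) :
    sepSet Γ G x (x * ofSyl Γ G ⟨u, s⟩) =
      {wallTrans Γ G x (halfSpace Γ G u),
        wallTrans Γ G (x * ofSyl Γ G ⟨u, s⟩) (halfSpace Γ G u)} := by
  ext W
  simp only [Set.mem_insert_iff, Set.mem_singleton_iff]
  constructor
  · rintro ⟨⟨k, v, rfl⟩, ⟨h1, h2⟩ | ⟨h1, h2⟩⟩
    · right
      refine cross_aux Γ G k v u _ s⁻¹ h2 ?_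
      rwa [ofSyl_inv, mul_inv_cancel_right]
    · left
      exact cross_aux Γ G k v u _ s h2 h1
  · rintro (rfl | rfl)
    · refine ⟨⟨_, _, rfl⟩, Or.inr ⟨?_, ?_⟩⟩
      · rw [mem_wall, inv_mul_cancel_left, gate_syl]; exact hs
      · rw [mem_wall, inv_mul_cancel, gate_one]; simp
    · refine ⟨⟨_, _, rfl⟩, Or.inl ⟨?_, ?_⟩⟩
      · rw [mem_wall, mul_inv_rev, inv_mul_cancel_right, ← ofSyl_inv, gate_syl]; simpa using hs
      · rw [mem_wall, inv_mul_cancel, gate_one]; simp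

theorem sep_main (n : ℕ) : ∀ g : GraphProduct Γ G, redLength Γ G g = n →
    (sepSet Γ G 1 g).Finite ∧ (sepSet Γ G 1 g).ncard = 2 * n := by
  induction n with
  | zero =>
    intro g hg
    obtain ⟨w, ⟨_, rfl⟩, hw⟩ := exists_red Γ G g
    rw [hg, List.length_eq_zero_iff] at hw
    subst hw
    have : sepSet Γ G 1 (wordProd Γ G []) = ∅ := by
      ext W
      simp [sepSet, wordProd, Xor', Xor]
    rw [this]
    simp
  | succ n ih =>
    intro g hg
    obtain ⟨w, ⟨hw1, rfl⟩, hw⟩ := exists_red Γ G g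
    rw [hg] at hw
    rcases List.eq_nil_or_concat' w with rfl | ⟨w, ⟨u, s⟩, rfl⟩
    · simp at hw
    have hs : s ≠ 1 := hw1 ⟨u, s⟩ (by simp)
    rw [wordProd_append, wordProd_single] at *
    have hl1 := redLength_le Γ G w
    have hl2 := redLength_mul_syl Γ G (wordProd Γ G w) ⟨u, s⟩
    simp at hw
    have hl : redLength Γ G (wordProd Γ G w) = n := by omega
    obtain ⟨hf, hc⟩ := ih _ hl
    set x := wordProd Γ G w with hx
    set y := x * ofSyl Γ G ⟨u, s⟩ with hy
    have hedge := sep_edge Γ G x u s hs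
    rw [← hy] at hedge
    have hne : wallTrans Γ G x (halfSpace Γ G u) ≠ wallTrans Γ G y (halfSpace Γ G u) := by
      intro h
      have h1 : x ∉ wallTrans Γ G x (halfSpace Γ G u) := by
        rw [mem_wall, inv_mul_cancel, gate_one]; simp
      rw [h, mem_wall, hy, mul_inv_rev, inv_mul_cancel_right, ← ofSyl_inv, gate_syl] at h1
      simp [hs] at h1
    have hdis : Disjoint (sepSet Γ G 1 x) (sepSet Γ G x y) := by
      rw [Set.disjoint_left]
      intro W hW1 hW2
      have hW2' := hW2
      rw [hedge] at hW2
      rcases hW2 with rfl | hW2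
      · have h1 : x ∉ wallTrans Γ G x (halfSpace Γ G u) := by
          rw [mem_wall, inv_mul_cancel, gate_one]; simp
        rcases hW1.2 with ⟨h, _⟩ | ⟨h, _⟩
        · rw [mem_wall, ← mem_halfSpace, mul_one] at h
          obtain ⟨a, ha⟩ := h
          rw [redLength_inv, ← redLength_inv, mul_inv_rev, inv_inv, ← ofSyl_inv] at ha
          have := redLength_mul_syl Γ G (x * ofSyl Γ G ⟨u, a⁻¹⟩) ⟨u, a * s⟩
          rw [ofSyl_mul, ofSyl_inv, ← mul_assoc, inv_mul_cancel_right, ← ofSyl_inv, ← hy] at this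
          omega
        · exact h1 h
      · rw [Set.mem_singleton_iff] at hW2
        subst hW2
        have h1 : y ∉ wallTrans Γ G y (halfSpace Γ G u) := by
          rw [mem_wall, inv_mul_cancel, gate_one]; simp
        have h2 : (1 : GraphProduct Γ G) ∈ wallTrans Γ G y (halfSpace Γ G u) := by
          rw [mem_wall, ← mem_halfSpace, mul_one]
          refine ⟨s, ?_⟩
          rw [redLength_inv, ← redLength_inv, mul_inv_rev, inv_inv, hy, mul_inv_cancel_right]
          rw [← hy]
          omega
        have a1 := hW1.2
        have a2 := hW2'.2
        simp only [Xor', Xor] at a1 a2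
        tauto
    have hun : sepSet Γ G 1 y = sepSet Γ G 1 x ∪ sepSet Γ G x y := by
      ext W
      have hd : W ∈ sepSet Γ G 1 x → W ∉ sepSet Γ G x y := fun h => Set.disjoint_left.1 hdis h
      simp only [sepSet, Set.mem_union, Set.mem_setOf_eq, Xor', Xor] at hd ⊢
      tauto
    have hf2 : (sepSet Γ G x y).Finite := by rw [hedge]; simp
    rw [hun]
    refine ⟨hf.union hf2, ?_⟩
    rw [Set.ncard_union_eq hdis hf hf2, hc, hedge, Set.ncard_pair hne]
    omega

end Aux

section Statements

variable {V : Type} [Fintype V] (Γ : SimpleGraph V) (G : V → Type) [∀ v, Group (G v)]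

theorem stmt10 (g : GraphProduct Γ G) :
    {s | s ∈ Walls Γ G ∧ Xor' ((1 : GraphProduct Γ G) ∈ s) (g ∈ s)}.Finite ∧
    wallDist Γ G 1 g = 2 * redLength Γ G g := by
  exact sep_main Γ G _ g rfl

end Statements
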